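/- Let 0<ρ<1, μ∈ℂ, α>0, and let (λ_k) be a nondecreasing sequence of positive reals with λ_k→∞. Then there exists a constant C>0 such that for every t>0, every square-summable complex sequence (g_k), and each choice of sign ∓, one has ∑_k |α∓√(α²−λ_k)|² |E_{ρ,μ}(−(α∓√(α²−λ_k)) t^ρ)|² |g_k|² ≤ C t^{−2ρ} ∑_k |g_k|². -/

import Mathlib

open Filter

/-- The two-parameter Mittag-Leffler function. -/
noncomputable def mlE (ρ : ℝ) (μ : ℂ) (z : ℂ) : ℂ :=
  ∑' k : ℕ, z ^ k / Complex.Gamma (((ρ * k : ℝ) : ℂ) + μ)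

/-- The principal complex square root of `α² - λ`. -/
noncomputable def sqrtD (α lam : ℝ) : ℂ := ((α ^ 2 - lam : ℝ) : ℂ) ^ ((1:ℂ)/2)


section

open MeasureTheory Set Topology

lemma norm_cpow_mul_exp_neg_mul (s r : ℂ) {t : ℝ} (ht : 0 < t) :
    ‖(t : ℂ) ^ s * Complex.exp (-(r * t))‖ = t ^ s.re * Real.exp (-r.re * t) := by
  rw [norm_mul, Complex.norm_cpow_eq_rpow_re_of_pos ht, Complex.norm_exp]
  simp

lemma aestronglyMeasurable_cpow_mul_exp_neg_mul (s r : ℂ) :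
    AEStronglyMeasurable (fun t : ℝ => (t : ℂ) ^ s * Complex.exp (-(r * t)))
      (volume.restrict (Ioi 0)) := by
  refine ContinuousOn.aestronglyMeasurable (fun t ht => ?_) measurableSet_Ioi
  refine ContinuousAt.continuousWithinAt ?_
  refine ContinuousAt.mul (ContinuousAt.cpow (by fun_prop) continuousAt_const ?_) ?_
  · exact Complex.ofReal_mem_slitPlane.2 ht
  · fun_prop

lemma integrableOn_rpow_mul_exp_neg_mul {x b : ℝ} (hx : -1 < x) (hb : 0 < b) :
    IntegrableOn (fun t : ℝ => t ^ x * Real.exp (-b * t)) (Ioi 0) := by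
  simpa using integrableOn_rpow_mul_exp_neg_mul_rpow hx one_pos hb

lemma integrableOn_cpow_mul_exp_neg_mul {s r : ℂ} (hs : -1 < s.re) (hr : 0 < r.re) :
    IntegrableOn (fun t : ℝ => (t : ℂ) ^ s * Complex.exp (-(r * t))) (Ioi 0) := by
  refine (integrableOn_rpow_mul_exp_neg_mul hs hr).mono'
    (aestronglyMeasurable_cpow_mul_exp_neg_mul s r) ?_
  filter_upwards [ae_restrict_mem measurableSet_Ioi] with t ht
  exact (norm_cpow_mul_exp_neg_mul s r ht).le

lemma differentiableAt_integral_cpow_mul_exp_neg_mul {s r : ℂ} (hs : 0 < s.re) (hr : 0 < r.re) :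
    DifferentiableAt ℂ
      (fun r : ℂ => ∫ t : ℝ in Ioi 0, (t : ℂ) ^ (s - 1) * Complex.exp (-(r * t))) r := by
  have hU : {w : ℂ | r.re / 2 < w.re} ∈ 𝓝 r :=
    (isOpen_lt continuous_const Complex.continuous_re).mem_nhds
      (show r.re / 2 < r.re by linarith)
  refine (hasDerivAt_integral_of_dominated_loc_of_deriv_le (𝕜 := ℂ)
    (μ := volume.restrict (Ioi (0 : ℝ)))
    (F := fun (r : ℂ) (t : ℝ) => (t : ℂ) ^ (s - 1) * Complex.exp (-(r * t)))
    (F' := fun (r : ℂ) (t : ℝ) => -((t : ℂ) ^ s * Complex.exp (-(r * t))))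
    (bound := fun t : ℝ => t ^ s.re * Real.exp (-(r.re / 2) * t))
    hU (Eventually.of_forall fun w => aestronglyMeasurable_cpow_mul_exp_neg_mul _ _)
    (integrableOn_cpow_mul_exp_neg_mul (by simpa using hs) hr)
    (aestronglyMeasurable_cpow_mul_exp_neg_mul _ _).neg ?_
    (integrableOn_rpow_mul_exp_neg_mul (by linarith) (by linarith)) ?_).2.differentiableAt
  · filter_upwards [ae_restrict_mem measurableSet_Ioi] with t ht w hw
    rw [norm_neg, norm_cpow_mul_exp_neg_mul s w ht]
    have ht' : 0 < t := ht
    have hw' : r.re / 2 < w.re := hw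
    gcongr
  · filter_upwards [ae_restrict_mem measurableSet_Ioi] with t ht w _
    have ht' : (t : ℂ) ≠ 0 := Complex.ofReal_ne_zero.2 (ne_of_gt ht)
    have h1 : HasDerivAt (fun w : ℂ => -(w * t)) (-(1 * (t : ℂ))) w :=
      ((hasDerivAt_id w).mul_const _).neg
    convert! h1.cexp.const_mul ((t : ℂ) ^ (s - 1)) using 1
    rw [Complex.cpow_sub _ _ ht', Complex.cpow_one]
    field_simp

/-- The Laplace transform of `t ^ (s - 1)` at a complex point of the right half-plane. -/
lemma integral_cpow_mul_exp_neg_mul_of_re_pos {s r : ℂ} (hs : 0 < s.re) (hr : 0 < r.re) :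
    ∫ t : ℝ in Ioi 0, (t : ℂ) ^ (s - 1) * Complex.exp (-(r * t)) =
      r ^ (-s) * Complex.Gamma s := by
  have hopen : IsOpen {w : ℂ | 0 < w.re} := isOpen_lt continuous_const Complex.continuous_re
  refine AnalyticOnNhd.eqOn_of_preconnected_of_frequently_eq (𝕜 := ℂ) (z₀ := 1)
    (U := {w : ℂ | 0 < w.re})
    (f := fun r : ℂ => ∫ t : ℝ in Ioi 0, (t : ℂ) ^ (s - 1) * Complex.exp (-(r * t)))
    (g := fun r : ℂ => r ^ (-s) * Complex.Gamma s) ?_ ?_ ?_ ?_ ?_ hr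
  · exact DifferentiableOn.analyticOnNhd (fun w hw =>
      (differentiableAt_integral_cpow_mul_exp_neg_mul hs hw).differentiableWithinAt) hopen
  · refine DifferentiableOn.analyticOnNhd (fun w hw => ?_) hopen
    have : w ∈ Complex.slitPlane := Or.inl hw
    exact ((differentiableAt_id.cpow_const this).mul_const _).differentiableWithinAt
  · exact (convex_halfSpace_re_gt 0).isPreconnected
  · simp
  · have h1 : Tendsto (fun x : ℝ => (x : ℂ)) (𝓝[>] 1) (𝓝[≠] 1) := by
      refine tendsto_nhdsWithin_iff.2 ⟨?_, ?_⟩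
      · exact (Complex.continuous_ofReal.tendsto' 1 1 (by simp)).mono_left nhdsWithin_le_nhds
      · filter_upwards [self_mem_nhdsWithin] with x hx
        have hx' : (1 : ℝ) < x := hx
        simpa using hx'.ne'
    refine h1.frequently (Eventually.frequently ?_)
    filter_upwards [self_mem_nhdsWithin] with x hx
    have hx' : (0 : ℝ) < x := lt_trans one_pos hx
    rw [Complex.integral_cpow_mul_exp_neg_mul_Ioi hs hx', one_div, Complex.inv_cpow,
      Complex.cpow_neg]
    rw [Complex.arg_ofReal_of_nonneg hx'.le]
    exact Real.pi_pos.ne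

/-- The vertical line of abscissa `c`, parametrised by `c + 2πiξ`. -/
noncomputable def vline (c ξ : ℝ) : ℂ := c + 2 * Real.pi * ξ * Complex.I

lemma vline_re (c ξ : ℝ) : (vline c ξ).re = c := by simp [vline]

lemma continuous_vline (c : ℝ) : Continuous (vline c) := by unfold vline; fun_prop

lemma le_norm_vline (c ξ : ℝ) : c ≤ ‖vline c ξ‖ := by
  simpa [vline_re] using Complex.re_le_norm (vline c ξ)

lemma vline_mem_slitPlane {c : ℝ} (hc : 0 < c) (ξ : ℝ) : vline c ξ ∈ Complex.slitPlane :=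
  Or.inl (by rwa [vline_re])

lemma continuous_vline_cpow {c : ℝ} (hc : 0 < c) (s : ℂ) : Continuous (fun ξ => vline c ξ ^ s) :=
  (continuous_vline c).cpow continuous_const (vline_mem_slitPlane hc)

lemma one_add_sq_le_norm_vline_sq {c : ℝ} (hc : 1 ≤ c) (ξ : ℝ) :
    1 + ‖ξ‖ ^ 2 ≤ ‖vline c ξ‖ ^ 2 := by
  have h : ‖vline c ξ‖ ^ 2 = c ^ 2 + (2 * Real.pi * ξ) ^ 2 := by
    rw [Complex.sq_norm, Complex.normSq_apply]
    simp [vline]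
    ring
  have hpi : (1 : ℝ) ≤ (2 * Real.pi) ^ 2 := by
    have := Real.pi_gt_three
    nlinarith
  rw [h, Real.norm_eq_abs, sq_abs, mul_pow]
  nlinarith [sq_nonneg ξ]

lemma norm_cpow_neg_le {u : ℂ} (hu : u ≠ 0) (s : ℂ) :
    ‖u ^ (-s)‖ ≤ Real.exp (Real.pi * |s.im|) * ‖u‖ ^ (-s.re) := by
  rw [Complex.norm_cpow_of_ne_zero hu, div_eq_mul_inv, ← Real.exp_neg, mul_comm]
  simp only [Complex.neg_re, Complex.neg_im, mul_neg, neg_neg]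
  refine mul_le_mul_of_nonneg_right (Real.exp_le_exp.2 ?_) (by positivity)
  calc u.arg * s.im ≤ |u.arg * s.im| := le_abs_self _
    _ = |u.arg| * |s.im| := abs_mul _ _
    _ ≤ Real.pi * |s.im| := by gcongr; exact Complex.abs_arg_le_pi u

lemma vline_ne_zero {c : ℝ} (hc : 0 < c) (ξ : ℝ) : vline c ξ ≠ 0 :=
  Complex.slitPlane_ne_zero (vline_mem_slitPlane hc ξ)

lemma integrable_norm_vline_rpow {c x : ℝ} (hc : 1 ≤ c) (hx : 1 < x) :
    Integrable (fun ξ => ‖vline c ξ‖ ^ (-x)) := by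
  have h0 : 0 < c := by linarith
  refine (integrable_rpow_neg_one_add_norm_sq (E := ℝ) (μ := volume) (r := x) (by simpa)).mono'
    ?_ (Eventually.of_forall fun ξ => ?_)
  · refine Continuous.aestronglyMeasurable ?_
    exact (continuous_vline c).norm.rpow_const
      fun ξ => Or.inl (norm_ne_zero_iff.2 (vline_ne_zero h0 ξ))
  · rw [Real.norm_of_nonneg (by positivity)]
    have : ‖vline c ξ‖ ^ (-x) = (‖vline c ξ‖ ^ 2) ^ (-x / 2) := by
      rw [← Real.rpow_natCast, ← Real.rpow_mul (norm_nonneg _)]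
      congr 1
      push_cast
      ring
    rw [this]
    exact Real.rpow_le_rpow_of_nonpos (by positivity) (one_add_sq_le_norm_vline_sq hc ξ)
      (by linarith)

lemma integrable_vline_cpow {c : ℝ} {s : ℂ} (hc : 1 ≤ c) (hs : 1 < s.re) :
    Integrable (fun ξ => vline c ξ ^ (-s)) := by
  have h0 : 0 < c := by linarith
  exact ((integrable_norm_vline_rpow hc hs).const_mul _).mono'
    (continuous_vline_cpow h0 _).aestronglyMeasurable
    (Eventually.of_forall fun ξ => norm_cpow_neg_le (vline_ne_zero h0 ξ) s)

open FourierTransform in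
/-- The inverse Laplace (Bromwich) representation of the reciprocal Gamma function. -/
lemma inv_Gamma_eq_integral {c : ℝ} {s : ℂ} (hc : 1 ≤ c) (hs : 1 < s.re) :
    (Complex.Gamma s)⁻¹ =
      Real.exp c * ∫ ξ : ℝ, Complex.exp (2 * Real.pi * ξ * Complex.I) * vline c ξ ^ (-s) := by
  have h0 : 0 < c := by linarith
  have hs0 : 0 < s.re := by linarith
  have hG : Complex.Gamma s ≠ 0 := Complex.Gamma_ne_zero_of_re_pos hs0
  set f : ℝ → ℂ := (Ioi (0 : ℝ)).indicator
    (fun t : ℝ => (t : ℂ) ^ (s - 1) * Complex.exp (-((c : ℂ) * t))) with hf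
  have hfint : Integrable f :=
    (integrable_indicator_iff measurableSet_Ioi).2
      (integrableOn_cpow_mul_exp_neg_mul (by simpa using hs0) (by simpa using h0))
  have hfour : 𝓕 f = fun ξ => vline c ξ ^ (-s) * Complex.Gamma s := by
    funext ξ
    rw [Real.fourier_real_eq_integral_exp_smul,
      ← integral_cpow_mul_exp_neg_mul_of_re_pos hs0 (r := vline c ξ) (by rwa [vline_re]),
      ← integral_indicator measurableSet_Ioi]
    congr 1 with t
    by_cases ht : t ∈ Ioi (0 : ℝ)
    · simp only [hf, indicator_of_mem ht, smul_eq_mul]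
      rw [mul_left_comm, ← Complex.exp_add]
      congr 2
      simp only [vline]
      push_cast
      ring
    · simp [hf, indicator_of_notMem ht]
  have hcont : ContinuousAt f 1 := by
    have : f =ᶠ[𝓝 1] fun t : ℝ => (t : ℂ) ^ (s - 1) * Complex.exp (-((c : ℂ) * t)) := by
      filter_upwards [Ioi_mem_nhds (zero_lt_one' ℝ)] with t ht
      exact indicator_of_mem ht _
    refine ContinuousAt.congr ?_ this.symm
    refine ContinuousAt.mul (ContinuousAt.cpow (by fun_prop) continuousAt_const ?_) (by fun_prop)
    simp
  have hinv := hfint.fourierInv_fourier_eq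
    (by rw [hfour]; exact (integrable_vline_cpow hc hs).mul_const _) hcont
  rw [hfour, Real.fourierInv_eq'] at hinv
  have hf1 : f 1 = Complex.exp (-c) := by simp [hf]
  rw [hf1] at hinv
  have h2 : (∫ ξ : ℝ, Complex.exp (2 * Real.pi * ξ * Complex.I) * vline c ξ ^ (-s)) *
      Complex.Gamma s = Complex.exp (-c) := by
    rw [← hinv, ← integral_mul_const]
    congr 1 with ξ
    simp [mul_assoc]
  rw [inv_eq_iff_eq_inv]
  refine eq_inv_of_mul_eq_one_right ?_
  rw [mul_assoc, h2, Complex.ofReal_exp,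
    ← Complex.exp_add]
  simp

lemma norm_exp_two_pi_mul_I (ξ : ℝ) : ‖Complex.exp (2 * Real.pi * ξ * Complex.I)‖ = 1 := by
  simpa using Complex.norm_exp_ofReal_mul_I (2 * Real.pi * ξ)

lemma norm_inv_Gamma_le {c : ℝ} {s : ℂ} (hc : 1 ≤ c) (hs : 1 < s.re) {x : ℝ} (hx : 0 ≤ x) :
    ‖(Complex.Gamma ((x : ℂ) + s))⁻¹‖ ≤
      c ^ (-x) * (Real.exp c * Real.exp (Real.pi * |s.im|) *
        ∫ ξ : ℝ, ‖vline c ξ‖ ^ (-s.re)) := by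
  have h0 : 0 < c := by linarith
  have hxs : 1 < ((x : ℂ) + s).re := by simp; linarith
  have hbound : ‖∫ ξ : ℝ, Complex.exp (2 * Real.pi * ξ * Complex.I) *
      vline c ξ ^ (-((x : ℂ) + s))‖ ≤
      ∫ ξ : ℝ, (c ^ (-x) * Real.exp (Real.pi * |s.im|)) * ‖vline c ξ‖ ^ (-s.re) := by
    refine norm_integral_le_of_norm_le ((integrable_norm_vline_rpow hc hs).const_mul _)
      (Eventually.of_forall fun ξ => ?_)
    have hpos : 0 < ‖vline c ξ‖ := h0.trans_le (le_norm_vline c ξ)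
    rw [norm_mul, norm_exp_two_pi_mul_I, one_mul]
    refine (norm_cpow_neg_le (vline_ne_zero h0 ξ) _).trans ?_
    have h2 : ‖vline c ξ‖ ^ (-((x : ℂ) + s).re) = ‖vline c ξ‖ ^ (-x) * ‖vline c ξ‖ ^ (-s.re) := by
      rw [← Real.rpow_add hpos]
      congr 1
      simp
      ring
    have h3 : ‖vline c ξ‖ ^ (-x) ≤ c ^ (-x) :=
      Real.rpow_le_rpow_of_nonpos h0 (le_norm_vline c ξ) (by linarith)
    have h4 : ((x : ℂ) + s).im = s.im := by simp
    rw [h2, h4, ← mul_assoc, mul_comm (c ^ (-x))]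
    gcongr
  rw [inv_Gamma_eq_integral hc hxs, norm_mul, Complex.norm_real,
    Real.norm_of_nonneg (Real.exp_pos c).le]
  refine (mul_le_mul_of_nonneg_left hbound (Real.exp_pos c).le).trans_eq ?_
  rw [integral_const_mul]
  ring

lemma exists_pow_mul_norm_inv_Gamma_le {ρ : ℝ} (hρ : 0 < ρ) (μ : ℂ) {R : ℝ} (hR : 0 < R) :
    ∃ C, ∀ k : ℕ, R ^ k * ‖(Complex.Gamma (((ρ * k : ℝ) : ℂ) + μ))⁻¹‖ ≤ C := by
  obtain ⟨N, hN⟩ := exists_nat_gt ((1 - μ.re) / ρ)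
  rw [div_lt_iff₀ hρ] at hN
  set c : ℝ := max 1 (R ^ (1 / ρ)) with hc
  have hc1 : 1 ≤ c := le_max_left _ _
  have hc0 : 0 < c := by linarith
  have hRc : R ≤ c ^ ρ := by
    calc R = (R ^ (1 / ρ)) ^ ρ := by
          rw [← Real.rpow_mul hR.le, one_div_mul_cancel hρ.ne', Real.rpow_one]
      _ ≤ c ^ ρ := Real.rpow_le_rpow (by positivity) (le_max_right _ _) hρ.le
  set s : ℂ := ((ρ * N : ℝ) : ℂ) + μ with hs
  have hs1 : 1 < s.re := by
    simp only [hs, Complex.add_re, Complex.ofReal_re]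
    linarith
  set K := Real.exp c * Real.exp (Real.pi * |s.im|) * ∫ ξ : ℝ, ‖vline c ξ‖ ^ (-s.re)
  have hK : 0 ≤ K := by
    have : 0 ≤ ∫ ξ : ℝ, ‖vline c ξ‖ ^ (-s.re) := integral_nonneg fun ξ => by positivity
    positivity
  refine ⟨R ^ N * K +
    ∑ j ∈ Finset.range N, R ^ j * ‖(Complex.Gamma (((ρ * j : ℝ) : ℂ) + μ))⁻¹‖, fun k => ?_⟩
  rcases lt_or_ge k N with hk | hk
  · refine (Finset.single_le_sum
      (f := fun j : ℕ => R ^ j * ‖(Complex.Gamma (((ρ * j : ℝ) : ℂ) + μ))⁻¹‖)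
      (fun j _ => by positivity) (Finset.mem_range.2 hk)).trans ?_
    exact le_add_of_nonneg_left (by positivity)
  · obtain ⟨m, rfl⟩ := Nat.exists_eq_add_of_le hk
    refine le_trans ?_ (le_add_of_nonneg_right (Finset.sum_nonneg fun j _ => by positivity))
    have harg : ((ρ * (N + m : ℕ) : ℝ) : ℂ) + μ = ((ρ * m : ℝ) : ℂ) + s := by
      simp only [hs]
      push_cast
      ring
    have hG := norm_inv_Gamma_le hc1 hs1 (x := ρ * m) (by positivity)
    rw [harg, pow_add, mul_assoc]
    refine mul_le_mul_of_nonneg_left ?_ (by positivity)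
    have hRm : R ^ m * c ^ (-(ρ * m)) ≤ 1 := by
      rw [Real.rpow_neg hc0.le, Real.rpow_mul hc0.le, Real.rpow_natCast, ← div_eq_mul_inv]
      exact div_le_one_of_le₀ (pow_le_pow_left₀ hR.le hRc m) (by positivity)
    calc R ^ m * ‖(Complex.Gamma (((ρ * m : ℝ) : ℂ) + s))⁻¹‖
        ≤ R ^ m * (c ^ (-(ρ * m)) * K) := by gcongr
      _ = (R ^ m * c ^ (-(ρ * m))) * K := by ring
      _ ≤ 1 * K := by gcongr
      _ = K := one_mul K

lemma exists_norm_mlE_term_le {ρ : ℝ} (hρ : 0 < ρ) (μ : ℂ) {R : ℝ} (hR : 0 < R) :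
    ∃ C, ∀ (k : ℕ) (z : ℂ), ‖z‖ ≤ R →
      ‖z ^ k / Complex.Gamma (((ρ * k : ℝ) : ℂ) + μ)‖ ≤ C * (1 / 2) ^ k := by
  obtain ⟨C, hC⟩ := exists_pow_mul_norm_inv_Gamma_le hρ μ (R := 2 * R) (by positivity)
  refine ⟨C, fun k z hz => ?_⟩
  have h1 : ‖z‖ ^ k ≤ R ^ k := by gcongr
  have h2 := hC k
  rw [mul_pow] at h2
  rw [div_eq_mul_inv, norm_mul, norm_pow, one_div, inv_pow, ← div_eq_mul_inv C,
    le_div_iff₀ (by positivity)]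
  calc _ ≤ R ^ k * ‖(Complex.Gamma (((ρ * k : ℝ) : ℂ) + μ))⁻¹‖ * 2 ^ k := by gcongr
    _ ≤ C := by linarith

lemma summable_mlE {ρ : ℝ} (hρ : 0 < ρ) (μ z : ℂ) :
    Summable fun k : ℕ => z ^ k / Complex.Gamma (((ρ * k : ℝ) : ℂ) + μ) := by
  obtain ⟨C, hC⟩ := exists_norm_mlE_term_le hρ μ (R := ‖z‖ + 1) (by positivity)
  exact .of_norm_bounded (summable_geometric_two.mul_left C) fun k => hC k z (by linarith)

lemma differentiable_mlE {ρ : ℝ} (hρ : 0 < ρ) (μ : ℂ) : Differentiable ℂ (mlE ρ μ) := by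
  intro z
  obtain ⟨C, hC⟩ := exists_norm_mlE_term_le hρ μ (R := ‖z‖ + 1) (by positivity)
  have hz : z ∈ Metric.ball (0 : ℂ) (‖z‖ + 1) := by simp
  refine (Complex.differentiableOn_tsum_of_summable_norm (summable_geometric_two.mul_left C)
    (fun k => ?_) Metric.isOpen_ball (fun k w hw => hC k w ?_)).differentiableAt
    (Metric.isOpen_ball.mem_nhds hz)
  · fun_prop
  · simpa using (mem_ball_zero_iff.1 hw).le

lemma hasSum_deriv_mlE {ρ : ℝ} (hρ : 0 < ρ) (μ z : ℂ) :
    HasSum (fun k : ℕ => k * z ^ (k - 1) / Complex.Gamma (((ρ * k : ℝ) : ℂ) + μ))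
      (deriv (mlE ρ μ) z) := by
  obtain ⟨C, hC⟩ := exists_norm_mlE_term_le hρ μ (R := ‖z‖ + 1) (by positivity)
  have hz : z ∈ Metric.ball (0 : ℂ) (‖z‖ + 1) := by simp
  have h := Complex.hasSum_deriv_of_summable_norm
    (F := fun (k : ℕ) (w : ℂ) => w ^ k / Complex.Gamma (((ρ * k : ℝ) : ℂ) + μ))
    (summable_geometric_two.mul_left C)
    (fun k => by fun_prop) Metric.isOpen_ball
    (fun k w hw => hC k w (mem_ball_zero_iff.1 hw).le) hz
  refine h.congr_fun ?_
  intro k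
  simp

lemma mlE_eq_add_mul {ρ : ℝ} (hρ : 0 < ρ) (μ z : ℂ) :
    mlE ρ μ z = (Complex.Gamma μ)⁻¹ + z * mlE ρ (μ + ρ) z := by
  unfold mlE
  rw [(summable_mlE hρ μ z).tsum_eq_zero_add, ← tsum_mul_left]
  congr 1
  · simp
  · congr 1 with k
    have : ((ρ * (k + 1 : ℕ) : ℝ) : ℂ) + μ = ((ρ * k : ℝ) : ℂ) + (μ + ρ) := by
      push_cast
      ring
    rw [this]
    ring

lemma mlE_eq_deriv {ρ : ℝ} (hρ : 0 < ρ) (μ z : ℂ) :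
    mlE ρ μ z = μ * mlE ρ (μ + 1) z + ρ * (z * deriv (mlE ρ (μ + 1)) z) := by
  have h1 := ((summable_mlE hρ (μ + 1) z).hasSum.mul_left μ).add
    (((hasSum_deriv_mlE hρ (μ + 1) z).mul_left z).mul_left (ρ : ℂ))
  refine Eq.trans ?_ h1.tsum_eq
  unfold mlE
  congr 1 with k
  rw [div_eq_mul_inv, Complex.one_div_Gamma_eq_self_mul_one_div_Gamma_add_one, add_assoc]
  rcases k with _ | k
  · simp [div_eq_mul_inv]
  · simp only [Nat.add_sub_cancel]
    push_cast
    ring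

/-- An open neighbourhood of the closed left half-plane which contains a sector of opening larger
than `π`. -/
def sectorNhd (a : ℝ) : Set ℂ := {z | z.re < a * (‖z‖ + 1)}

lemma isOpen_sectorNhd (a : ℝ) : IsOpen (sectorNhd a) :=
  isOpen_lt Complex.continuous_re (by fun_prop)

lemma zero_mem_sectorNhd {a : ℝ} (ha : 0 < a) : (0 : ℂ) ∈ sectorNhd a := by
  simpa [sectorNhd] using ha

lemma isPreconnected_sectorNhd {a : ℝ} (ha : 0 < a) : IsPreconnected (sectorNhd a) := by
  refine IsConnected.isPreconnected (IsPathConnected.isConnected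
    (StarConvex.isPathConnected (a := 0) ?_ (zero_mem_sectorNhd ha)))
  refine starConvex_zero_iff.2 fun z hz t ht0 ht1 => ?_
  have hz' : z.re < a * (‖z‖ + 1) := hz
  change (t • z).re < a * (‖t • z‖ + 1)
  rw [norm_smul, Real.norm_of_nonneg ht0, Complex.smul_re, smul_eq_mul]
  rcases ht0.eq_or_lt with rfl | ht
  · simpa using ha
  · nlinarith [mul_lt_mul_of_pos_left hz' ht]

lemma mem_sectorNhd_of_re_nonpos {a : ℝ} (ha : 0 < a) {z : ℂ} (hz : z.re ≤ 0) :
    z ∈ sectorNhd a := by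
  have : 0 < a * (‖z‖ + 1) := by positivity
  exact lt_of_le_of_lt hz this

lemma closedBall_subset_sectorNhd {a : ℝ} (ha : 0 < a) (ha1 : a ≤ 1) {z : ℂ}
    (hz : z ∈ sectorNhd (a / 4)) :
    Metric.closedBall z (a / 4 * (‖z‖ + 1)) ⊆ sectorNhd a := by
  intro w hw
  have hz' : z.re < a / 4 * (‖z‖ + 1) := hz
  rw [mem_closedBall_iff_norm] at hw
  have h1 : w.re - z.re ≤ ‖w - z‖ := by simpa using Complex.re_le_norm (w - z)
  have h2 : ‖z‖ ≤ ‖w‖ + ‖w - z‖ := by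
    rw [norm_sub_rev]
    simpa using norm_add_le w (z - w)
  change w.re < a * (‖w‖ + 1)
  have h3 : a / 4 * (‖z‖ + 1) ≤ 1 / 4 * (‖z‖ + 1) := by gcongr
  have h4 : a * (3 / 4 * (‖z‖ + 1)) ≤ a * (‖w‖ + 1) := by
    gcongr
    linarith
  nlinarith [norm_nonneg z]

lemma cos_mul_norm_cpow_le_re {ρ : ℝ} (hρ0 : 0 < ρ) (hρ1 : ρ < 1) {u : ℂ} (hu : 0 < u.re) :
    Real.cos (Real.pi / 2 * ρ) * ‖u ^ (ρ : ℂ)‖ ≤ (u ^ (ρ : ℂ)).re := by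
  have hu0 : u ≠ 0 := by
    rintro rfl
    simp at hu
  have harg : |u.arg| ≤ Real.pi / 2 := Complex.abs_arg_le_pi_div_two_iff.2 hu.le
  rw [Complex.cpow_def_of_ne_zero hu0, Complex.norm_exp, Complex.exp_re, mul_comm]
  have him : (Complex.log u * ρ).im = u.arg * ρ := by simp [Complex.log_im]
  rw [him, ← Real.cos_abs (u.arg * ρ), abs_mul, abs_of_pos hρ0]
  refine mul_le_mul_of_nonneg_left ?_ (Real.exp_pos _).le
  refine Real.cos_le_cos_of_nonneg_of_le_pi (by positivity) ?_ (by gcongr)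
  nlinarith [Real.pi_pos]

lemma mul_norm_le_mul_norm_sub {a b : ℝ} (ha : 0 < a) {v z : ℂ} (hv : b * ‖v‖ ≤ v.re)
    (hv1 : 1 ≤ ‖v‖) (hz : z ∈ sectorNhd a) : (b - 2 * a) * ‖v‖ ≤ (1 + a) * ‖v - z‖ := by
  have hz' : z.re < a * (‖z‖ + 1) := hz
  have h1 : v.re - z.re ≤ ‖v - z‖ := by simpa using Complex.re_le_norm (v - z)
  have h2 : ‖z‖ ≤ ‖v‖ + ‖v - z‖ := by
    rw [norm_sub_rev]
    simpa using norm_add_le v (z - v)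
  nlinarith [mul_le_mul_of_nonneg_left h2 ha.le, mul_le_mul_of_nonneg_left hv1 ha.le]

lemma norm_vline_cpow_neg_le_one {ρ : ℝ} (hρ0 : 0 < ρ) (ξ : ℝ) :
    ‖vline 1 ξ ^ (-(ρ : ℂ))‖ ≤ 1 := by
  rw [← Complex.ofReal_neg, Complex.norm_cpow_real]
  exact Real.rpow_le_one_of_one_le_of_nonpos (le_norm_vline 1 ξ) (by linarith)

lemma le_norm_one_sub_mul_vline_cpow {ρ a : ℝ} (hρ0 : 0 < ρ) (hρ1 : ρ < 1) (ha : 0 < a) {z : ℂ}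
    (hz : z ∈ sectorNhd a) (ξ : ℝ) :
    (Real.cos (Real.pi / 2 * ρ) - 2 * a) / (1 + a) ≤ ‖1 - z * vline 1 ξ ^ (-(ρ : ℂ))‖ := by
  have hv1 : 1 ≤ ‖vline 1 ξ ^ (ρ : ℂ)‖ := by
    rw [Complex.norm_cpow_real]
    exact Real.one_le_rpow (le_norm_vline 1 ξ) hρ0.le
  have hv0 : vline 1 ξ ^ (ρ : ℂ) ≠ 0 := norm_pos_iff.1 (by linarith)
  have hre := cos_mul_norm_cpow_le_re hρ0 hρ1 (u := vline 1 ξ) (by simp [vline_re])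
  have h := mul_norm_le_mul_norm_sub ha hre hv1 hz
  have heq : 1 - z * vline 1 ξ ^ (-(ρ : ℂ)) =
      (vline 1 ξ ^ (ρ : ℂ) - z) / vline 1 ξ ^ (ρ : ℂ) := by
    rw [Complex.cpow_neg]
    field_simp
  rw [heq, norm_div, div_le_div_iff₀ (by linarith) (by linarith)]
  linarith

/-- The integrand of the Bromwich representation of the Mittag-Leffler function. -/
noncomputable def mlKernel (ρ : ℝ) (μ z : ℂ) (ξ : ℝ) : ℂ :=
  Complex.exp (2 * Real.pi * ξ * Complex.I) * vline 1 ξ ^ (-μ) *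
    (1 - z * vline 1 ξ ^ (-(ρ : ℂ)))⁻¹

lemma measurable_vline_cpow (s : ℂ) : Measurable fun ξ => vline 1 ξ ^ s :=
  (continuous_vline_cpow one_pos s).measurable

lemma measurable_mlKernel (ρ : ℝ) (μ z : ℂ) : Measurable (mlKernel ρ μ z) := by
  have h1 := measurable_vline_cpow (-μ)
  have h2 := measurable_vline_cpow (-(ρ : ℂ))
  unfold mlKernel
  fun_prop

lemma norm_mlKernel_le {ρ κ : ℝ} (hκ : 0 < κ) {μ z : ℂ} {ξ : ℝ}
    (h : κ ≤ ‖1 - z * vline 1 ξ ^ (-(ρ : ℂ))‖) :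
    ‖mlKernel ρ μ z ξ‖ ≤ κ⁻¹ * ‖vline 1 ξ ^ (-μ)‖ := by
  rw [mlKernel, norm_mul, norm_mul, norm_exp_two_pi_mul_I, one_mul, norm_inv, mul_comm]
  gcongr

section Bromwich

variable {ρ a : ℝ} {μ : ℂ}

lemma integrable_mlKernel (hμ : 1 < μ.re) {κ : ℝ} (hκ : 0 < κ) {z : ℂ}
    (h : ∀ ξ, κ ≤ ‖1 - z * vline 1 ξ ^ (-(ρ : ℂ))‖) : Integrable (mlKernel ρ μ z) :=
  ((integrable_vline_cpow le_rfl hμ).norm.const_mul κ⁻¹).mono'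
    (measurable_mlKernel ρ μ z).aestronglyMeasurable
    (Eventually.of_forall fun ξ => norm_mlKernel_le hκ (h ξ))

lemma differentiableOn_integral_mlKernel (hρ0 : 0 < ρ) (hμ : 1 < μ.re) {U : Set ℂ}
    (hU : IsOpen U) {κ : ℝ} (hκ : 0 < κ)
    (h : ∀ z ∈ U, ∀ ξ, κ ≤ ‖1 - z * vline 1 ξ ^ (-(ρ : ℂ))‖) :
    DifferentiableOn ℂ (fun z => ∫ ξ, mlKernel ρ μ z ξ) U := by
  intro z hz
  refine DifferentiableAt.differentiableWithinAt ?_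
  refine (hasDerivAt_integral_of_dominated_loc_of_deriv_le (𝕜 := ℂ) (F := mlKernel ρ μ)
    (F' := fun w ξ => mlKernel ρ μ w ξ *
      (vline 1 ξ ^ (-(ρ : ℂ)) * (1 - w * vline 1 ξ ^ (-(ρ : ℂ)))⁻¹))
    (bound := fun ξ => κ⁻¹ * ‖vline 1 ξ ^ (-μ)‖ * (1 * κ⁻¹)) (hU.mem_nhds hz)
    (Eventually.of_forall fun w => (measurable_mlKernel ρ μ w).aestronglyMeasurable)
    (integrable_mlKernel hμ hκ (h z hz)) ?_ ?_
    (((integrable_vline_cpow le_rfl hμ).norm.const_mul κ⁻¹).mul_const _) ?_).2.differentiableAt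
  · have h1 := measurable_mlKernel ρ μ z
    have h2 := measurable_vline_cpow (-(ρ : ℂ))
    exact Measurable.aestronglyMeasurable (by fun_prop)
  · refine Eventually.of_forall fun ξ w hw => ?_
    rw [norm_mul, norm_mul, norm_inv]
    have := norm_mlKernel_le (μ := μ) hκ (h w hw ξ)
    have := norm_vline_cpow_neg_le_one hρ0 ξ
    have := h w hw ξ
    gcongr
  · refine Eventually.of_forall fun ξ w hw => ?_
    have hne : 1 - w * vline 1 ξ ^ (-(ρ : ℂ)) ≠ 0 :=
      norm_pos_iff.1 (hκ.trans_le (h w hw ξ))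
    have h1 : HasDerivAt (fun w : ℂ => 1 - w * vline 1 ξ ^ (-(ρ : ℂ)))
        (-(1 * vline 1 ξ ^ (-(ρ : ℂ)))) w :=
      ((hasDerivAt_id w).mul_const _).const_sub 1
    convert! (h1.inv hne).const_mul
      (Complex.exp (2 * Real.pi * ξ * Complex.I) * vline 1 ξ ^ (-μ)) using 1
    rw [mlKernel]
    field_simp

lemma mlE_eq_integral_of_norm_lt_one (hρ0 : 0 < ρ) (hμ : 1 < μ.re) {z : ℂ} (hz : ‖z‖ < 1) :
    mlE ρ μ z = Real.exp 1 * ∫ ξ, mlKernel ρ μ z ξ := by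
  set F : ℕ → ℝ → ℂ := fun k ξ => Complex.exp (2 * Real.pi * ξ * Complex.I) *
    vline 1 ξ ^ (-μ) * (z * vline 1 ξ ^ (-(ρ : ℂ))) ^ k with hF
  have hFle : ∀ k ξ, ‖F k ξ‖ ≤ ‖z‖ ^ k * ‖vline 1 ξ ^ (-μ)‖ := fun k ξ => by
    rw [hF, norm_mul, norm_mul, norm_exp_two_pi_mul_I, one_mul, norm_pow, norm_mul, mul_comm]
    gcongr
    exact mul_le_of_le_one_right (norm_nonneg _) (norm_vline_cpow_neg_le_one hρ0 ξ)
  have hint := (integrable_vline_cpow le_rfl hμ).norm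
  have hFint : ∀ k, Integrable (F k) := fun k => by
    refine (hint.const_mul (‖z‖ ^ k)).mono' ?_ (Eventually.of_forall (hFle k))
    have h1 := measurable_vline_cpow (-μ)
    have h2 := measurable_vline_cpow (-(ρ : ℂ))
    exact Measurable.aestronglyMeasurable (by fun_prop)
  have hsum : Summable fun k => ∫ ξ, ‖F k ξ‖ := by
    refine Summable.of_nonneg_of_le (fun k => integral_nonneg fun ξ => norm_nonneg _)
      (fun k => ?_) ((summable_geometric_of_lt_one (norm_nonneg z) hz).mul_right
        (∫ ξ, ‖vline 1 ξ ^ (-μ)‖))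
    rw [← integral_const_mul]
    exact integral_mono (hFint k).norm (hint.const_mul _) (hFle k)
  have h := (hasSum_integral_of_summable_integral_norm hFint hsum).mul_left
    ((Real.exp 1 : ℝ) : ℂ)
  have hker : (fun ξ => ∑' k, F k ξ) = mlKernel ρ μ z := by
    funext ξ
    have hlt : ‖z * vline 1 ξ ^ (-(ρ : ℂ))‖ < 1 := by
      rw [norm_mul]
      exact (mul_le_of_le_one_right (norm_nonneg _) (norm_vline_cpow_neg_le_one hρ0 ξ)).trans_lt hz
    rw [hF, tsum_mul_left, tsum_geometric_of_norm_lt_one hlt, mlKernel]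
  rw [hker] at h
  rw [← h.tsum_eq, mlE]
  congr 1 with k
  have hre : 1 < (((ρ * k : ℝ) : ℂ) + μ).re := by
    have : 0 ≤ ρ * k := by positivity
    simp only [Complex.add_re, Complex.ofReal_re]
    linarith
  rw [div_eq_mul_inv, inv_Gamma_eq_integral le_rfl hre, mul_left_comm, ← integral_const_mul]
  congr 2 with ξ
  have hpow : vline 1 ξ ^ (-(((ρ * k : ℝ) : ℂ) + μ)) =
      vline 1 ξ ^ (-μ) * (vline 1 ξ ^ (-(ρ : ℂ))) ^ k := by
    rw [← Complex.cpow_mul_nat, ← Complex.cpow_add _ _ (vline_ne_zero one_pos ξ)]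
    congr 1
    push_cast
    ring
  simp only [hpow, hF, mul_pow]
  ring

lemma mlE_eq_integral (hρ0 : 0 < ρ) (hρ1 : ρ < 1) (hμ : 1 < μ.re) (ha : 0 < a)
    (ha' : 2 * a < Real.cos (Real.pi / 2 * ρ)) {z : ℂ} (hz : z ∈ sectorNhd a) :
    mlE ρ μ z = Real.exp 1 * ∫ ξ, mlKernel ρ μ z ξ := by
  have hκ : 0 < (Real.cos (Real.pi / 2 * ρ) - 2 * a) / (1 + a) := by
    apply div_pos <;> linarith
  refine AnalyticOnNhd.eqOn_of_preconnected_of_eventuallyEq (𝕜 := ℂ) (U := sectorNhd a)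
    (f := mlE ρ μ) (g := fun z => Real.exp 1 * ∫ ξ, mlKernel ρ μ z ξ)
    ((differentiable_mlE hρ0 μ).differentiableOn.analyticOnNhd (isOpen_sectorNhd a))
    (DifferentiableOn.analyticOnNhd ?_ (isOpen_sectorNhd a))
    (isPreconnected_sectorNhd ha) (zero_mem_sectorNhd ha) ?_ hz
  · exact (differentiableOn_integral_mlKernel hρ0 hμ (isOpen_sectorNhd a) hκ
      fun z hz ξ => le_norm_one_sub_mul_vline_cpow hρ0 hρ1 ha hz ξ).const_mul _
  · filter_upwards [Metric.ball_mem_nhds (0 : ℂ) one_pos] with w hw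
    exact mlE_eq_integral_of_norm_lt_one hρ0 hμ (mem_ball_zero_iff.1 hw)

end Bromwich

/-- The Mittag-Leffler function `E_{ρ,μ}` is bounded on a neighbourhood of the closed left
half-plane when `0 < ρ < 1`. -/
lemma exists_norm_mlE_le {ρ : ℝ} (hρ0 : 0 < ρ) (hρ1 : ρ < 1) (μ : ℂ) :
    ∃ a C : ℝ, 0 < a ∧ a ≤ 1 ∧ 0 ≤ C ∧ ∀ z ∈ sectorNhd a, ‖mlE ρ μ z‖ ≤ C := by
  obtain ⟨n, hn⟩ := exists_nat_gt (1 - μ.re)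
  induction n generalizing μ with
  | zero =>
    have hμ : 1 < μ.re := by
      simp only [Nat.cast_zero] at hn
      linarith
    have hcos : 0 < Real.cos (Real.pi / 2 * ρ) := by
      apply Real.cos_pos_of_mem_Ioo
      constructor <;> nlinarith [Real.pi_pos]
    have hcos1 := Real.cos_le_one (Real.pi / 2 * ρ)
    set a := Real.cos (Real.pi / 2 * ρ) / 3 with ha
    have ha0 : 0 < a := by positivity
    have hκ : 0 < (Real.cos (Real.pi / 2 * ρ) - 2 * a) / (1 + a) := by
      apply div_pos <;> linarith
    set κ := (Real.cos (Real.pi / 2 * ρ) - 2 * a) / (1 + a)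
    have hI : 0 ≤ ∫ ξ, ‖vline 1 ξ ^ (-μ)‖ := integral_nonneg fun ξ => norm_nonneg _
    refine ⟨a, Real.exp 1 * (κ⁻¹ * ∫ ξ, ‖vline 1 ξ ^ (-μ)‖), ha0, by linarith, by positivity,
      fun z hz => ?_⟩
    rw [mlE_eq_integral hρ0 hρ1 hμ ha0 (by linarith) hz, norm_mul, Complex.norm_real,
      Real.norm_of_nonneg (Real.exp_pos 1).le, ← integral_const_mul]
    refine mul_le_mul_of_nonneg_left ?_ (Real.exp_pos 1).le
    exact norm_integral_le_of_norm_le ((integrable_vline_cpow le_rfl hμ).norm.const_mul _)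
      (Eventually.of_forall fun ξ =>
        norm_mlKernel_le hκ (le_norm_one_sub_mul_vline_cpow hρ0 hρ1 ha0 hz ξ))
  | succ n ih =>
    obtain ⟨a, C, ha0, ha1, hC0, hC⟩ := ih (μ + 1) (by
      push_cast at hn
      simp only [Complex.add_re, Complex.one_re]
      linarith)
    refine ⟨a / 4, ‖μ‖ * C + ρ * (C / (a / 4)), by positivity, by linarith, by positivity,
      fun z hz => ?_⟩
    have hsub := closedBall_subset_sectorNhd ha0 ha1 hz
    have hr : 0 < a / 4 * (‖z‖ + 1) := by positivity
    have hd := Complex.norm_deriv_le_of_forall_mem_sphere_norm_le hr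
      (differentiable_mlE hρ0 (μ + 1)).diffContOnCl
      fun w hw => hC w (hsub (Metric.sphere_subset_closedBall hw))
    have hz0 : z ∈ sectorNhd a := hsub (Metric.mem_closedBall_self hr.le)
    have hzd : ‖z * deriv (mlE ρ (μ + 1)) z‖ ≤ C / (a / 4) := by
      rw [norm_mul]
      calc ‖z‖ * ‖deriv (mlE ρ (μ + 1)) z‖
          ≤ (‖z‖ + 1) * (C / (a / 4 * (‖z‖ + 1))) := by
            gcongr
            linarith
        _ = C / (a / 4) := by field_simp
    rw [mlE_eq_deriv hρ0 μ z]
    refine (norm_add_le _ _).trans ?_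
    rw [norm_mul, norm_mul (ρ : ℂ), Complex.norm_real, Real.norm_of_nonneg hρ0.le]
    have := hC z hz0
    gcongr

/-- `z E_{ρ,μ}(z)` is bounded on the closed left half-plane when `0 < ρ < 1`. -/
lemma exists_norm_mul_norm_mlE_le {ρ : ℝ} (hρ0 : 0 < ρ) (hρ1 : ρ < 1) (μ : ℂ) :
    ∃ C : ℝ, 0 < C ∧ ∀ z : ℂ, z.re ≤ 0 → ‖z‖ * ‖mlE ρ μ z‖ ≤ C := by
  obtain ⟨a, C, ha0, -, hC0, hC⟩ := exists_norm_mlE_le hρ0 hρ1 (μ - ρ)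
  refine ⟨C + ‖(Complex.Gamma (μ - ρ))⁻¹‖ + 1, by positivity, fun z hz => ?_⟩
  have h := mlE_eq_add_mul hρ0 (μ - ρ) z
  rw [sub_add_cancel] at h
  have hzE : z * mlE ρ μ z = mlE ρ (μ - ρ) z - (Complex.Gamma (μ - ρ))⁻¹ := by
    rw [h]
    ring
  rw [← norm_mul, hzE]
  have h1 := norm_sub_le (mlE ρ (μ - ρ) z) (Complex.Gamma (μ - ρ))⁻¹
  have h2 := hC z (mem_sectorNhd_of_re_nonpos ha0 hz)
  linarith

lemma abs_re_sqrtD_le {α lam : ℝ} (hα : 0 < α) (hlam : 0 < lam) : |(sqrtD α lam).re| ≤ α := by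
  have hsq : sqrtD α lam ^ 2 = ((α ^ 2 - lam : ℝ) : ℂ) := by
    rw [sqrtD, ← Complex.cpow_mul_nat]
    norm_num
  have hre := congrArg Complex.re hsq
  have him := congrArg Complex.im hsq
  simp only [sq, Complex.mul_re, Complex.mul_im, Complex.ofReal_re, Complex.ofReal_im] at hre him
  refine abs_le_of_sq_le_sq ?_ hα.le
  have hprod : (sqrtD α lam).re * (sqrtD α lam).im = 0 := by linarith
  rcases mul_eq_zero.1 hprod with h | h
  · rw [h]
    nlinarith
  · rw [h] at hre
    nlinarith

lemma re_add_mul_sqrtD_nonneg {α lam : ℝ} (hα : 0 < α) (hlam : 0 < lam) {σ : ℂ}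
    (hσ : σ = 1 ∨ σ = -1) : 0 ≤ ((α : ℂ) + σ * sqrtD α lam).re := by
  have h := abs_le.1 (abs_re_sqrtD_le hα hlam)
  rcases hσ with rfl | rfl <;> simp <;> linarith

end

/-- Weighted spectral estimate:
`∑ₖ |α∓√(α²-λₖ)|² |E_{ρ,μ}(-(α∓√(α²-λₖ))t^ρ)|² |gₖ|² ≤ C t^{-2ρ} ∑ₖ |gₖ|²`. -/
theorem spectral_estimate_S
    (ρ : ℝ) (hρ0 : 0 < ρ) (hρ1 : ρ < 1) (μ : ℂ) (α : ℝ) (hα : 0 < α)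
    (lam : ℕ → ℝ) (hlam_pos : ∀ k, 0 < lam k) (hlam_mono : Monotone lam)
    (hlam_tend : Tendsto lam atTop atTop) :
    ∃ C > (0:ℝ), ∀ t : ℝ, 0 < t → ∀ g : ℕ → ℂ, Summable (fun k => ‖g k‖ ^ 2) →
      ∀ σ : ℂ, (σ = 1 ∨ σ = -1) →
        (∑' k, ‖(α : ℂ) + σ * sqrtD α (lam k)‖ ^ 2 *
            ‖mlE ρ μ (-(((α : ℂ) + σ * sqrtD α (lam k))) * ((t ^ ρ : ℝ) : ℂ))‖ ^ 2 *
            ‖g k‖ ^ 2) ≤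
          C * t ^ (-(2 * ρ)) * ∑' k, ‖g k‖ ^ 2 := by
  obtain ⟨C, hC0, hC⟩ := exists_norm_mul_norm_mlE_le hρ0 hρ1 μ
  refine ⟨C ^ 2, by positivity, fun t ht g hg σ hσ => ?_⟩
  have hterm : ∀ k, ‖(α : ℂ) + σ * sqrtD α (lam k)‖ ^ 2 *
      ‖mlE ρ μ (-(((α : ℂ) + σ * sqrtD α (lam k))) * ((t ^ ρ : ℝ) : ℂ))‖ ^ 2 * ‖g k‖ ^ 2 ≤
      C ^ 2 * t ^ (-(2 * ρ)) * ‖g k‖ ^ 2 := fun k => by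
    refine mul_le_mul_of_nonneg_right ?_ (by positivity)
    have hw := re_add_mul_sqrtD_nonneg hα (hlam_pos k) hσ
    set w := (α : ℂ) + σ * sqrtD α (lam k)
    have htρ : 0 < t ^ ρ := Real.rpow_pos_of_pos ht ρ
    have hz : (-w * ((t ^ ρ : ℝ) : ℂ)).re ≤ 0 := by
      rw [Complex.re_mul_ofReal, Complex.neg_re]
      nlinarith
    have h := hC _ hz
    rw [norm_mul, norm_neg, Complex.norm_real, Real.norm_of_nonneg htρ.le] at h
    have hpow : t ^ (-(2 * ρ)) = ((t ^ ρ) ^ 2)⁻¹ := by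
      rw [Real.rpow_neg ht.le, mul_comm, Real.rpow_mul ht.le, Real.rpow_two]
    rw [hpow, ← div_eq_mul_inv, le_div_iff₀ (by positivity)]
    calc ‖w‖ ^ 2 * ‖mlE ρ μ (-w * ((t ^ ρ : ℝ) : ℂ))‖ ^ 2 * (t ^ ρ) ^ 2
        = (‖w‖ * t ^ ρ * ‖mlE ρ μ (-w * ((t ^ ρ : ℝ) : ℂ))‖) ^ 2 := by ring
      _ ≤ C ^ 2 := by gcongr
  have hsum := hg.mul_left (C ^ 2 * t ^ (-(2 * ρ)))
  rw [← tsum_mul_left]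
  exact Summable.tsum_le_tsum hterm
    (Summable.of_nonneg_of_le (fun k => by positivity) hterm hsum) hsum
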